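/- Let w ∈ A₁ be a weight on ℝⁿ and let b satisfy ‖b‖_{BMO_{1,w}} := sup_Q (1/w(Q)) ∫_Q |b − b_Q| dx < ∞. Then for every q > 1 and every cube Q, ( (1/w(Q)) ∫_Q |(b(x) − b_Q)/w(x)|^q w(x) dx )^{1/q} ≤ c_n ‖b‖_{BMO_{1,w}} · q · [w]_{A₁}^{1/q'} · [w]_{A∞}^{1/q}, where c_n is a dimensional constant and 1/q + 1/q' = 1. -/

import Mathlib

open MeasureTheory ENNReal Set

noncomputable section

/-- The axis-parallel cube in `ℝⁿ` with lower corner `a` and side length `h`. -/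
def Cube {n : ℕ} (a : Fin n → ℝ) (h : ℝ) : Set (Fin n → ℝ) :=
  Set.univ.pi fun i => Set.Icc (a i) (a i + h)

/-- The concentric double `2Q` of the cube with lower corner `a` and side length `h`. -/
def Cube2 {n : ℕ} (a : Fin n → ℝ) (h : ℝ) : Set (Fin n → ℝ) :=
  Cube (fun i => a i - h / 2) (2 * h)

/-- The average `f_Q` of `f` over the cube with lower corner `a` and side length `h`. -/
def cubeAvg {n : ℕ} (a : Fin n → ℝ) (h : ℝ) (f : (Fin n → ℝ) → ℝ) : ℝ :=
  ⨍ x in Cube a h, f x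

/-- The (uncentered) Hardy–Littlewood maximal function over axis-parallel cubes. -/
def maxFn {n : ℕ} (f : (Fin n → ℝ) → ℝ) (x : Fin n → ℝ) : ℝ≥0∞ :=
  ⨆ (a : Fin n → ℝ) (h : ℝ) (_ : 0 < h) (_ : x ∈ Cube a h),
    (∫⁻ y in Cube a h, ENNReal.ofReal |f y|) / volume (Cube a h)

/-- The BMO seminorm `sup_Q (1/|Q|) ∫_Q |f - f_Q|`, valued in `ℝ≥0∞`. -/
def bmoNorm {n : ℕ} (f : (Fin n → ℝ) → ℝ) : ℝ≥0∞ :=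
  ⨆ (a : Fin n → ℝ) (h : ℝ) (_ : 0 < h),
    (∫⁻ x in Cube a h, ENNReal.ofReal |f x - cubeAvg a h f|) / volume (Cube a h)

/-- The generalized weighted BMO norm `‖f‖_{BMO_{v,Y}} = sup_Q (1/Y(Q)) ∫_Q |f - f_Q| v`. -/
def bmoVY {n : ℕ} (v : (Fin n → ℝ) → ℝ) (Y : (Fin n → ℝ) → ℝ → ℝ≥0∞)
    (f : (Fin n → ℝ) → ℝ) : ℝ≥0∞ :=
  ⨆ (a : Fin n → ℝ) (h : ℝ) (_ : 0 < h),
    (∫⁻ x in Cube a h, ENNReal.ofReal (|f x - cubeAvg a h f| * v x)) / Y a h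

/-- `w(Q) = ∫_Q w` for a cube `Q`. -/
def wInt {n : ℕ} (w : (Fin n → ℝ) → ℝ) (a : Fin n → ℝ) (h : ℝ) : ℝ≥0∞ :=
  ∫⁻ x in Cube a h, ENNReal.ofReal (w x)

/-- `w(2Q) = ∫_{2Q} w` for a cube `Q`. -/
def wInt2 {n : ℕ} (w : (Fin n → ℝ) → ℝ) (a : Fin n → ℝ) (h : ℝ) : ℝ≥0∞ :=
  ∫⁻ x in Cube2 a h, ENNReal.ofReal (w x)

/-- The generalized Fujii–Wilson constant `[v]_{A_{∞,Y}} = sup_Q (1/Y(Q)) ∫_Q M(v χ_Q)`. -/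
def fwY {n : ℕ} (v : (Fin n → ℝ) → ℝ) (Y : (Fin n → ℝ) → ℝ → ℝ≥0∞) : ℝ≥0∞ :=
  ⨆ (a : Fin n → ℝ) (h : ℝ) (_ : 0 < h),
    (∫⁻ x in Cube a h, maxFn ((Cube a h).indicator v) x) / Y a h

/-- The Fujii–Wilson `A∞` constant `[w]_{A∞} = sup_Q (1/w(Q)) ∫_Q M(w χ_Q)`. -/
def fwConst {n : ℕ} (w : (Fin n → ℝ) → ℝ) : ℝ≥0∞ :=
  ⨆ (a : Fin n → ℝ) (h : ℝ) (_ : 0 < h),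
    (∫⁻ x in Cube a h, maxFn ((Cube a h).indicator w) x) / wInt w a h

/-- The weak Fujii–Wilson constant `[w]^{weak}_{A∞} = sup_Q (1/w(2Q)) ∫_Q M(w χ_Q)`. -/
def fwWeak {n : ℕ} (w : (Fin n → ℝ) → ℝ) : ℝ≥0∞ :=
  ⨆ (a : Fin n → ℝ) (h : ℝ) (_ : 0 < h),
    (∫⁻ x in Cube a h, maxFn ((Cube a h).indicator w) x) / wInt2 w a h

/-- The `C_p` normalizing functional `Y(Q) = ∫_{ℝⁿ} M(χ_Q)^p w`. -/
def cpY {n : ℕ} (p : ℝ) (w : (Fin n → ℝ) → ℝ) (a : Fin n → ℝ) (h : ℝ) : ℝ≥0∞ :=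
  ∫⁻ x, (maxFn ((Cube a h).indicator fun _ => (1 : ℝ)) x) ^ p * ENNReal.ofReal (w x)

/-- The `C_p` Fujii–Wilson-type constant `[w]_{C_p}`. -/
def cpConst {n : ℕ} (p : ℝ) (w : (Fin n → ℝ) → ℝ) : ℝ≥0∞ :=
  ⨆ (a : Fin n → ℝ) (h : ℝ) (_ : 0 < h),
    (∫⁻ x in Cube a h, maxFn ((Cube a h).indicator w) x) / cpY p w a h

/-- The `A_p` constant `[w]_{A_p}` for `1 < p < ∞`. -/
def apConst {n : ℕ} (p : ℝ) (w : (Fin n → ℝ) → ℝ) : ℝ≥0∞ :=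
  ⨆ (a : Fin n → ℝ) (h : ℝ) (_ : 0 < h),
    (wInt w a h / volume (Cube a h)) *
      ((∫⁻ x in Cube a h, ENNReal.ofReal (w x) ^ (1 - p / (p - 1))) / volume (Cube a h)) ^ (p - 1)

/-- A weight: a nonnegative locally integrable function on `ℝⁿ`. -/
def IsWeight {n : ℕ} (v : (Fin n → ℝ) → ℝ) : Prop :=
  (∀ x, 0 ≤ v x) ∧ LocallyIntegrable v volume

/-- A cube functional `Y : 𝒬 → (0,∞)`: positive finite values on cubes. -/
def IsCubeFunctional {n : ℕ} (Y : (Fin n → ℝ) → ℝ → ℝ≥0∞) : Prop :=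
  ∀ (a : Fin n → ℝ) (h : ℝ), 0 < h → 0 < Y a h ∧ Y a h < ⊤

/-- Membership in the class `𝒴_q` with constant `β`: for every cube `Q`, every `L ≥ 1`
and every `L`-small family of pairwise non-overlapping subcubes of `Q`,
`∑_{P ∈ Λ} Y(P) ≤ β Y(Q) L^{-1/q}`. -/
def MemY {n : ℕ} (q β : ℝ) (Y : (Fin n → ℝ) → ℝ → ℝ≥0∞) : Prop :=
  ∀ (a : Fin n → ℝ) (h : ℝ), 0 < h → ∀ L : ℝ, 1 ≤ L →
    ∀ Λ : Set ((Fin n → ℝ) × ℝ),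
      (∀ p ∈ Λ, 0 < p.2 ∧ Cube p.1 p.2 ⊆ Cube a h) →
      (Λ.Pairwise fun p r => Disjoint (interior (Cube p.1 p.2)) (interior (Cube r.1 r.2))) →
      (∑' p : Λ, volume (Cube p.1.1 p.1.2)) ≤ volume (Cube a h) / ENNReal.ofReal L →
      (∑' p : Λ, Y p.1.1 p.1.2) ≤ ENNReal.ofReal β * Y a h * ENNReal.ofReal (L ^ (-1 / q))

/-- The Luxemburg norm in the Orlicz space `exp L^β` with respect to the measure `μ`. -/
def expLuxNorm {X : Type*} [MeasurableSpace X] (μ : Measure X) (β : ℝ) (g : X → ℝ) : ℝ≥0∞ :=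
  ⨅ (lam : ℝ) (_ : 0 < lam)
    (_ : ∫⁻ x, ENNReal.ofReal (Real.exp ((|g x| / lam) ^ β) - 1) ∂μ ≤ 1), ENNReal.ofReal lam

/-- The weighted measure `w dx` restricted to a set `Q`. -/
def wMeasureOn {n : ℕ} (w : (Fin n → ℝ) → ℝ) (Q : Set (Fin n → ℝ)) : Measure (Fin n → ℝ) :=
  (volume.restrict Q).withDensity fun x => ENNReal.ofReal (w x)

/-- The dyadic grid `𝒟(Q)` relative to the cube with lower corner `a₀` and side `h₀`:
parameters of all dyadic subcubes of `Q`. -/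
def dyadicOf {n : ℕ} (a₀ : Fin n → ℝ) (h₀ : ℝ) : Set ((Fin n → ℝ) × ℝ) :=
  {p | ∃ (k : ℕ) (m : Fin n → ℕ), (∀ i, m i < 2 ^ k) ∧
    p.2 = h₀ / 2 ^ k ∧ p.1 = fun i => a₀ i + (m i : ℝ) * (h₀ / 2 ^ k)}

/-- The functional `w_r(Q) = |Q| ((1/|Q|) ∫_Q w^r)^{1/r}`. -/
def wrY {n : ℕ} (w : (Fin n → ℝ) → ℝ) (r : ℝ) (a : Fin n → ℝ) (h : ℝ) : ℝ≥0∞ :=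
  volume (Cube a h) *
    ((∫⁻ x in Cube a h, ENNReal.ofReal (w x) ^ r) / volume (Cube a h)) ^ (1 / r)

theorem cube_eq_Icc {n : ℕ} (a : Fin n → ℝ) (h : ℝ) :
    Cube a h = Icc a (fun i => a i + h) := by
  simp [Cube, Set.pi_univ_Icc]

theorem measurableSet_cube {n : ℕ} (a : Fin n → ℝ) (h : ℝ) : MeasurableSet (Cube a h) := by
  rw [cube_eq_Icc]; exact measurableSet_Icc

theorem isCompact_cube {n : ℕ} (a : Fin n → ℝ) (h : ℝ) : IsCompact (Cube a h) := by
  rw [cube_eq_Icc]; exact isCompact_Icc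

theorem volume_cube {n : ℕ} (a : Fin n → ℝ) (h : ℝ) :
    volume (Cube a h) = ENNReal.ofReal h ^ n := by
  simp [cube_eq_Icc, Real.volume_Icc_pi]

theorem volume_cube_ne_zero {n : ℕ} (a : Fin n → ℝ) {h : ℝ} (hh : 0 < h) :
    volume (Cube a h) ≠ 0 := by
  rw [volume_cube]; positivity

theorem volume_cube_ne_top {n : ℕ} (a : Fin n → ℝ) (h : ℝ) : volume (Cube a h) ≠ ⊤ := by
  rw [volume_cube]; finiteness

/-- The lower corner of the dyadic child of a cube selected by the sign vector `ε`. -/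
def childCorner {n : ℕ} (a : Fin n → ℝ) (h : ℝ) (ε : Fin n → Bool) : Fin n → ℝ :=
  fun i => a i + if ε i then h / 2 else 0

/-- The sign vector of a dyadic child containing `x`. -/
def childIndex {n : ℕ} (a : Fin n → ℝ) (h : ℝ) (x : Fin n → ℝ) : Fin n → Bool :=
  fun i => decide (a i + h / 2 ≤ x i)

theorem mem_child {n : ℕ} {a : Fin n → ℝ} {h : ℝ} {x : Fin n → ℝ} (hx : x ∈ Cube a h) :
    x ∈ Cube (childCorner a h (childIndex a h x)) (h / 2) := by
  intro i _
  have := hx i trivial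
  simp only [childCorner, childIndex, mem_Icc, decide_eq_true_eq] at this ⊢
  split_ifs <;> constructor <;> linarith

theorem child_subset {n : ℕ} (a : Fin n → ℝ) {h : ℝ} (hh : 0 < h) (ε : Fin n → Bool) :
    Cube (childCorner a h ε) (h / 2) ⊆ Cube a h := by
  intro x hx i _
  have := hx i trivial
  simp only [childCorner, mem_Icc] at this ⊢
  split_ifs at this <;> constructor <;> linarith

theorem volume_child {n : ℕ} (a : Fin n → ℝ) (h : ℝ) (ε : Fin n → Bool) :
    volume (Cube a h) = 2 ^ n * volume (Cube (childCorner a h ε) (h / 2)) := by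
  rw [volume_cube, volume_cube, ← mul_pow]
  congr 1
  rw [show (2 : ℝ≥0∞) = ENNReal.ofReal 2 by simp, ← ENNReal.ofReal_mul (by norm_num)]
  congr 1; ring

theorem measurable_childIndex {n : ℕ} (a : Fin n → ℝ) (h : ℝ) :
    Measurable (childIndex a h) := by
  refine measurable_pi_iff.2 fun i => ?_
  refine measurable_to_bool ?_
  have : (fun x => childIndex a h x i) ⁻¹' {true} = {x | a i + h / 2 ≤ x i} := by
    ext x; simp [childIndex]
  rw [this]
  exact measurableSet_le measurable_const (measurable_pi_apply i)

theorem cube_ae_eq_pi_Ico {n : ℕ} (a : Fin n → ℝ) (h : ℝ) :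
    Cube a h =ᵐ[volume] univ.pi fun i => Ico (a i) (a i + h) := by
  rw [cube_eq_Icc]
  exact (Measure.univ_pi_Ico_ae_eq_Icc (μ := fun _ : Fin n => (volume : Measure ℝ))
    (f := a) (g := fun i => a i + h)).symm

/-- An integral over a cube is the sum of the integrals over its dyadic children. -/
theorem lintegral_cube_eq_sum_children {n : ℕ} (a : Fin n → ℝ) {h : ℝ} (hh : 0 < h)
    (F : (Fin n → Bool) → (Fin n → ℝ) → ℝ≥0∞) :
    ∫⁻ x in Cube a h, F (childIndex a h x) x =
      ∑ ε, ∫⁻ x in Cube (childCorner a h ε) (h / 2), F ε x := by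
  have hmeas : ∀ ε, MeasurableSet
      (univ.pi fun i => Ico (childCorner a h ε i) (childCorner a h ε i + h / 2)) :=
    fun ε => MeasurableSet.univ_pi fun i => measurableSet_Ico
  have hidx : ∀ ε, ∀ x ∈ univ.pi fun i => Ico (childCorner a h ε i) (childCorner a h ε i + h / 2),
      childIndex a h x = ε := by
    intro ε x hx
    funext i
    have := hx i trivial
    simp only [childCorner, mem_Ico] at this
    cases hε : ε i <;> simp [hε] at this <;> simp [childIndex] <;> linarith
  have hunion : (univ.pi fun i => Ico (a i) (a i + h)) =
      ⋃ ε, univ.pi fun i => Ico (childCorner a h ε i) (childCorner a h ε i + h / 2) := by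
    ext x
    simp only [mem_iUnion]
    constructor
    · intro hx
      refine ⟨childIndex a h x, fun i _ => ?_⟩
      have := hx i trivial
      simp only [childCorner, childIndex, mem_Ico, decide_eq_true_eq] at this ⊢
      split_ifs <;> constructor <;> linarith
    · rintro ⟨ε, hx⟩ i -
      have := hx i trivial
      simp only [childCorner, mem_Ico] at this ⊢
      split_ifs at this <;> constructor <;> linarith
  rw [setLIntegral_congr (cube_ae_eq_pi_Ico a h), hunion, lintegral_iUnion hmeas, tsum_fintype]
  · refine Finset.sum_congr rfl fun ε _ => ?_
    rw [setLIntegral_congr (cube_ae_eq_pi_Ico _ _)]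
    exact setLIntegral_congr_fun (hmeas ε) fun x hx => by simp only [hidx ε x hx]
  · intro ε ε' hne
    refine Set.disjoint_left.2 fun x hx hx' => hne ?_
    rw [← hidx ε x hx, hidx ε' x hx']

theorem volume_cube_eq_sum_children {n : ℕ} (a : Fin n → ℝ) {h : ℝ} (hh : 0 < h) :
    volume (Cube a h) = ∑ ε, volume (Cube (childCorner a h ε) (h / 2)) := by
  simpa using lintegral_cube_eq_sum_children a hh fun _ _ => 1

/-- The averages of `b` over the `m`-th generation dyadic subcubes of a cube. -/
def dyadicApprox {n : ℕ} (b : (Fin n → ℝ) → ℝ) :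
    ℕ → (Fin n → ℝ) → ℝ → (Fin n → ℝ) → ℝ
  | 0, a, h, _ => cubeAvg a h b
  | m + 1, a, h, x => dyadicApprox b m (childCorner a h (childIndex a h x)) (h / 2) x

theorem measurable_dyadicApprox {n : ℕ} (b : (Fin n → ℝ) → ℝ) (m : ℕ) :
    ∀ a h, Measurable (dyadicApprox b m a h) := by
  induction m with
  | zero => exact fun a h => measurable_const
  | succ m ih =>
    intro a h
    have : Measurable fun p : (Fin n → Bool) × (Fin n → ℝ) =>
        dyadicApprox b m (childCorner a h p.1) (h / 2) p.2 :=
      measurable_from_prod_countable_right fun ε => ih (childCorner a h ε) (h / 2)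
    exact this.comp ((measurable_childIndex a h).prodMk measurable_id)

theorem dyadicApprox_eq_cubeAvg {n : ℕ} (b : (Fin n → ℝ) → ℝ) (x : Fin n → ℝ) (m : ℕ) :
    ∀ a h, x ∈ Cube a h →
      ∃ a', x ∈ Cube a' (h / 2 ^ m) ∧ dyadicApprox b m a h x = cubeAvg a' (h / 2 ^ m) b := by
  induction m with
  | zero => exact fun a h hx => ⟨a, by simpa using hx, by simp [dyadicApprox]⟩
  | succ m ih =>
    intro a h hx
    obtain ⟨a', h1, h2⟩ := ih _ _ (mem_child hx)
    have : h / 2 / 2 ^ m = h / 2 ^ (m + 1) := by rw [pow_succ]; field_simp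
    rw [this] at h1 h2
    exact ⟨a', h1, h2⟩

theorem cube_eq_closedBall {n : ℕ} (a : Fin n → ℝ) {h : ℝ} (hh : 0 < h) :
    Cube a h = Metric.closedBall (fun i => a i + h / 2) (h / 2) := by
  rw [closedBall_pi _ (by positivity)]
  refine Set.pi_congr rfl fun i _ => ?_
  rw [Real.closedBall_eq_Icc]
  congr 1 <;> ring

theorem ae_tendsto_dyadicApprox {n : ℕ} {b : (Fin n → ℝ) → ℝ} (hb : LocallyIntegrable b volume)
    (a : Fin n → ℝ) {h : ℝ} (hh : 0 < h) :
    ∀ᵐ x ∂volume.restrict (Cube a h),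
      Filter.Tendsto (fun m => dyadicApprox b m a h x) Filter.atTop (nhds (b x)) := by
  filter_upwards [ae_restrict_of_ae (IsUnifLocDoublingMeasure.ae_tendsto_average volume hb 1),
    ae_restrict_mem (measurableSet_cube a h)] with x hx hmem
  choose a' h1 h2 using fun m => dyadicApprox_eq_cubeAvg b x m a h hmem
  have hpos : ∀ m : ℕ, 0 < h / 2 ^ m := fun m => by positivity
  have h3 := hx (l := Filter.atTop) (fun m i => a' m i + h / 2 ^ m / 2)
    (fun m : ℕ => h / 2 ^ m / 2) ?_ ?_
  · refine h3.congr fun m => ?_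
    rw [h2, cubeAvg, cube_eq_closedBall _ (hpos m)]
  · refine tendsto_nhdsWithin_iff.2 ⟨?_, .of_forall fun m => half_pos (hpos m)⟩
    have := (tendsto_pow_atTop_nhds_zero_of_lt_one (r := (1 / 2 : ℝ)) (by norm_num)
      (by norm_num)).const_mul (h / 2)
    rw [mul_zero] at this
    refine this.congr fun m => ?_
    rw [div_pow, one_pow]; ring
  · refine .of_forall fun m => ?_
    rw [one_mul, ← cube_eq_closedBall _ (hpos m)]
    exact h1 m

theorem abs_cubeAvg_sub_le {n : ℕ} {b : (Fin n → ℝ) → ℝ} (hb : LocallyIntegrable b volume)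
    (a : Fin n → ℝ) {h : ℝ} (hh : 0 < h) {c l : ℝ} (hl : 0 ≤ l)
    (hI : ∫⁻ x in Cube a h, ENNReal.ofReal |b x - c| ≤
      ENNReal.ofReal l * volume (Cube a h)) :
    |cubeAvg a h b - c| ≤ l := by
  have hbi : IntegrableOn b (Cube a h) := hb.integrableOn_isCompact (isCompact_cube a h)
  have hv0 := volume_cube_ne_zero a hh
  have hv1 := volume_cube_ne_top a h
  have hvr : 0 < volume.real (Cube a h) := ENNReal.toReal_pos hv0 hv1
  have hci : IntegrableOn (fun _ => c) (Cube a h) :=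
    integrableOn_const hv1
  have key : ∫ x in Cube a h, (b x - c) = volume.real (Cube a h) * (cubeAvg a h b - c) := by
    rw [integral_sub hbi hci, cubeAvg, setAverage_eq]
    simp only [integral_const, smul_eq_mul, measureReal_restrict_apply_univ]
    field_simp
  have h1 := enorm_integral_le_lintegral_enorm (μ := volume.restrict (Cube a h))
    fun x => b x - c
  simp only [Real.enorm_eq_ofReal_abs] at h1
  rw [key, abs_mul, abs_of_pos hvr, mul_comm, ENNReal.ofReal_mul (abs_nonneg _),
    measureReal_def, ENNReal.ofReal_toReal hv1] at h1
  have h2 := h1.trans hI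
  rw [ENNReal.mul_le_mul_iff_left hv0 hv1] at h2
  exact (ENNReal.ofReal_le_ofReal_iff hl).1 h2

theorem add_rpow_le_rpow_add_mul {u v q : ℝ} (hu : 0 ≤ u) (hv : 0 ≤ v) (hq : 1 ≤ q) :
    (u + v) ^ q ≤ u ^ q + q * v * (u + v) ^ (q - 1) := by
  rcases (add_nonneg hu hv).eq_or_lt' with hz | hz
  · have hu0 : u = 0 := by linarith
    have hv0 : v = 0 := by linarith
    simp [hu0, hv0]
  have h1 : (-1 : ℝ) ≤ -(v / (u + v)) := by
    rw [neg_le_neg_iff, div_le_one hz]; linarith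
  have h2 := one_add_mul_self_le_rpow_one_add h1 hq
  have h3 : 1 + -(v / (u + v)) = u / (u + v) := by field_simp; ring
  rw [h3, Real.div_rpow hu hz.le] at h2
  have h4 : 0 < (u + v) ^ q := Real.rpow_pos_of_pos hz q
  rw [le_div_iff₀ h4] at h2
  rw [Real.rpow_sub_one hz.ne']
  calc (u + v) ^ q = (1 + q * -(v / (u + v))) * (u + v) ^ q + q * v * ((u + v) ^ q / (u + v)) := by
        field_simp; ring
    _ ≤ _ := by gcongr

theorem rpow_sub_one_le_mul_exp {y q : ℝ} (hy : 0 ≤ y) (hq : 1 < q) :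
    y ^ (q - 1) ≤ q ^ (q - 1) * Real.exp y := by
  have hq0 : 0 < q := by linarith
  have h1 : y ≤ q * Real.exp (y / q) := by
    have := Real.add_one_le_exp (y / q)
    calc y = q * (y / q) := by field_simp
      _ ≤ _ := by gcongr; linarith
  calc y ^ (q - 1) ≤ (q * Real.exp (y / q)) ^ (q - 1) :=
        Real.rpow_le_rpow hy h1 (by linarith)
    _ = q ^ (q - 1) * Real.exp (y / q * (q - 1)) := by
        rw [Real.mul_rpow hq0.le (Real.exp_pos _).le, ← Real.exp_mul]
    _ ≤ _ := by
        gcongr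
        rw [div_mul_eq_mul_div, div_le_iff₀ hq0]
        nlinarith

theorem abs_div_rpow_mul_le {z w L A μ q : ℝ} (hw : 0 < w) (hL : 0 ≤ L)
    (hμw : μ ≤ A * w) (hz : |z| ≤ L * μ) (hq : 1 < q) :
    |z / w| ^ q * w ≤ L * (L * A) ^ (q - 1) * μ := by
  have h1 : |z / w| ≤ L * A := by
    rw [abs_div, abs_of_pos hw, div_le_iff₀ hw, mul_assoc]
    exact hz.trans (by gcongr)
  have hLA : 0 ≤ L * A := (abs_nonneg _).trans h1
  calc |z / w| ^ q * w = |z / w| ^ (q - 1) * |z / w| * w := by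
        rw [← Real.rpow_add_one' (abs_nonneg _) (by linarith)]; ring_nf
    _ = |z / w| ^ (q - 1) * |z| := by
        rw [mul_assoc, abs_div z, abs_of_pos hw, div_mul_cancel₀ _ hw.ne']
    _ ≤ (L * A) ^ (q - 1) * (L * μ) := by
        have : 0 ≤ q - 1 := by linarith
        gcongr
    _ = _ := by ring

theorem exp_one_third_le : Real.exp (1 / 3) ≤ 3 / 2 := by
  have h := Real.exp_one_lt_d9
  by_contra! hc
  have h3 : Real.exp 1 = Real.exp (1 / 3) ^ 3 := by
    rw [← Real.exp_nat_mul]; norm_num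
  have : (3 / 2 : ℝ) ^ 3 < Real.exp (1 / 3) ^ 3 := by gcongr
  rw [← h3] at this
  norm_num at this
  linarith

theorem abs_sub_div_rpow_mul_le {y c c' w L A μ q : ℝ} (hw : 0 < w) (hμ : 0 < μ) (hL : 0 < L)
    (hμw : μ ≤ A * w) (hc : |c' - c| ≤ L * μ) (hq : 1 < q) :
    |(y - c) / w| ^ q * w ≤ |(y - c') / w| ^ q * w +
      3 / 2 * (L * q ^ q * (3 * L * A) ^ (q - 1)) * μ *
        Real.exp (|y - c'| / (3 * L * A * w)) := by
  have hq0 : 0 < q := by linarith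
  have hA : 0 < A := by
    by_contra! h
    nlinarith
  set κ := 3 * L * A with hκ
  have hκ0 : 0 < κ := by positivity
  set u := |(y - c') / w| with hu
  have hu' : u = |y - c'| / w := by rw [hu, abs_div, abs_of_pos hw]
  set v := L * μ / w with hv
  have hu0 : 0 ≤ u := abs_nonneg _
  have hv0 : 0 ≤ v := by positivity
  have hvw : v * w = L * μ := div_mul_cancel₀ _ hw.ne'
  have hle : |(y - c) / w| ≤ u + v := by
    rw [abs_div, abs_of_pos hw, hu', hv, ← add_div]
    gcongr
    exact (abs_sub_le y c' c).trans (by gcongr)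
  have hvκ : v ≤ κ * (1 / 3) := by
    rw [hv, div_le_iff₀ hw, hκ]
    calc L * μ ≤ L * (A * w) := by gcongr
      _ = _ := by ring
  have huv : u + v ≤ κ * (u / κ + 1 / 3) := by
    rw [mul_add, mul_div_cancel₀ _ hκ0.ne']; gcongr
  have hq1 : 0 ≤ q - 1 := by linarith
  have hexp : |y - c'| / (κ * w) = u / κ := by
    rw [hu', div_div, mul_comm w]
  have hpow : (u + v) ^ (q - 1) ≤ κ ^ (q - 1) * (q ^ (q - 1) * (3 / 2 * Real.exp (u / κ))) := by
    calc (u + v) ^ (q - 1) ≤ (κ * (u / κ + 1 / 3)) ^ (q - 1) := by gcongr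
      _ = κ ^ (q - 1) * (u / κ + 1 / 3) ^ (q - 1) := Real.mul_rpow hκ0.le (by positivity)
      _ ≤ κ ^ (q - 1) * (q ^ (q - 1) * Real.exp (u / κ + 1 / 3)) := by
          gcongr; exact rpow_sub_one_le_mul_exp (by positivity) hq
      _ ≤ _ := by
          rw [add_comm (u / κ), Real.exp_add]
          gcongr; exact exp_one_third_le
  rw [hexp]
  calc |(y - c) / w| ^ q * w ≤ (u + v) ^ q * w := by gcongr
    _ ≤ (u ^ q + q * v * (u + v) ^ (q - 1)) * w := by
        gcongr; exact add_rpow_le_rpow_add_mul hu0 hv0 hq.le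
    _ = u ^ q * w + q * (v * w) * (u + v) ^ (q - 1) := by ring
    _ ≤ u ^ q * w + q * (L * μ) * (κ ^ (q - 1) * (q ^ (q - 1) * (3 / 2 * Real.exp (u / κ)))) := by
        rw [hvw]; gcongr
    _ = u ^ q * w + 3 / 2 * (L * (q ^ (q - 1) * q) * κ ^ (q - 1)) * μ * Real.exp (u / κ) := by ring
    _ = _ := by
        rw [← Real.rpow_add_one hq0.ne', sub_add_cancel]

theorem wInt_ne_top {n : ℕ} {w : (Fin n → ℝ) → ℝ} (hw : LocallyIntegrable w volume)
    (a : Fin n → ℝ) (h : ℝ) : wInt w a h ≠ ⊤ :=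
  (hw.integrableOn_isCompact (isCompact_cube a h)).lintegral_lt_top.ne

theorem wInt_ne_zero {n : ℕ} {w : (Fin n → ℝ) → ℝ} (hw : LocallyIntegrable w volume)
    {a : Fin n → ℝ} {h : ℝ} (hh : 0 < h) (hpos : ∀ᵐ x ∂volume.restrict (Cube a h), 0 < w x) :
    wInt w a h ≠ 0 := by
  intro h0
  rw [wInt, lintegral_eq_zero_iff' hw.aestronglyMeasurable.aemeasurable.ennreal_ofReal.restrict]
    at h0
  have h2 : ∀ᵐ x ∂volume.restrict (Cube a h), False := by
    filter_upwards [h0, hpos] with x hx hx'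
    exact absurd (ENNReal.ofReal_eq_zero.1 hx) (not_le.2 hx')
  rw [Filter.eventually_false_iff_eq_bot, ae_eq_bot, Measure.restrict_eq_zero] at h2
  exact volume_cube_ne_zero a hh h2

/-- The average of a weight over a cube. -/
def wAvg {n : ℕ} (w : (Fin n → ℝ) → ℝ) (a : Fin n → ℝ) (h : ℝ) : ℝ :=
  (wInt w a h / volume (Cube a h)).toReal

/-- The standing assumptions on a symbol `b` and a weight `w` inside a fixed set `S`: weighted
bounded oscillation with constant `N`, the `A₁` condition with constant `A`, and a majorant `G`
of the averages of `w`. -/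
structure BloomData {n : ℕ} (b w : (Fin n → ℝ) → ℝ) (N A : ℝ) (S : Set (Fin n → ℝ))
    (G : (Fin n → ℝ) → ℝ≥0∞) : Prop where
  locallyIntegrable : LocallyIntegrable b volume
  weight_locallyIntegrable : LocallyIntegrable w volume
  weight_pos : ∀ᵐ x ∂volume.restrict S, 0 < w x
  N_pos : 0 < N
  A_pos : 0 < A
  osc_le : ∀ a h, 0 < h → Cube a h ⊆ S →
    ∫⁻ x in Cube a h, ENNReal.ofReal |b x - cubeAvg a h b| ≤ ENNReal.ofReal N * wInt w a h
  wInt_le : ∀ᵐ x ∂volume, ∀ a h, 0 < h → x ∈ Cube a h →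
    wInt w a h ≤ ENNReal.ofReal A * ENNReal.ofReal (w x) * volume (Cube a h)
  wInt_le_majorant : ∀ a h, 0 < h → Cube a h ⊆ S → ∀ x ∈ Cube a h,
    wInt w a h ≤ G x * volume (Cube a h)

/-- The states of the dyadic stopping-time argument: a current cube together with the reference
average `c` of `b` and the reference average `μ` of `w`. -/
structure Admissible {n : ℕ} (b w : (Fin n → ℝ) → ℝ) (N A : ℝ) (S : Set (Fin n → ℝ))
    (G : (Fin n → ℝ) → ℝ≥0∞) (a : Fin n → ℝ) (h c μ : ℝ) : Prop where
  side_pos : 0 < h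
  level_pos : 0 < μ
  subset : Cube a h ⊆ S
  level_le_weight : ∀ᵐ x ∂volume.restrict (Cube a h), μ ≤ A * w x
  level_le_majorant : ∀ x ∈ Cube a h, ENNReal.ofReal μ ≤ G x
  osc_le : ∫⁻ x in Cube a h, ENNReal.ofReal |b x - c| ≤
    ENNReal.ofReal (2 * N * μ) * volume (Cube a h)

namespace BloomData

variable {n : ℕ} {b w : (Fin n → ℝ) → ℝ} {N A : ℝ} {S : Set (Fin n → ℝ)}
  {G : (Fin n → ℝ) → ℝ≥0∞}

theorem ofReal_wAvg_mul_volume (D : BloomData b w N A S G) (a : Fin n → ℝ) {h : ℝ}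
    (hh : 0 < h) : ENNReal.ofReal (wAvg w a h) * volume (Cube a h) = wInt w a h := by
  have hv := volume_cube_ne_zero a hh
  rw [wAvg, ENNReal.ofReal_toReal (ENNReal.div_ne_top (wInt_ne_top D.weight_locallyIntegrable a h) hv),
    ENNReal.div_mul_cancel hv (volume_cube_ne_top a h)]

theorem wAvg_pos (D : BloomData b w N A S G) {a : Fin n → ℝ} {h : ℝ} (hh : 0 < h)
    (hS : Cube a h ⊆ S) : 0 < wAvg w a h :=
  ENNReal.toReal_pos (ENNReal.div_ne_zero.2 ⟨wInt_ne_zero D.weight_locallyIntegrable hh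
      (ae_restrict_of_ae_restrict_of_subset hS D.weight_pos), volume_cube_ne_top a h⟩)
    (ENNReal.div_ne_top (wInt_ne_top D.weight_locallyIntegrable a h) (volume_cube_ne_zero a hh))

theorem osc_le_wAvg (D : BloomData b w N A S G) {a : Fin n → ℝ} {h : ℝ} (hh : 0 < h)
    (hS : Cube a h ⊆ S) : ∫⁻ x in Cube a h, ENNReal.ofReal |b x - cubeAvg a h b| ≤
      ENNReal.ofReal (N * wAvg w a h) * volume (Cube a h) := by
  rw [ENNReal.ofReal_mul D.N_pos.le, mul_assoc, D.ofReal_wAvg_mul_volume a hh]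
  exact D.osc_le a h hh hS

theorem admissible_self (D : BloomData b w N A S G) {a : Fin n → ℝ} {h : ℝ} (hh : 0 < h)
    (hS : Cube a h ⊆ S) : Admissible b w N A S G a h (cubeAvg a h b) (wAvg w a h) where
  side_pos := hh
  level_pos := D.wAvg_pos hh hS
  subset := hS
  level_le_weight := by
    filter_upwards [ae_restrict_of_ae D.wInt_le, ae_restrict_mem (measurableSet_cube a h),
      ae_restrict_of_ae_restrict_of_subset hS D.weight_pos] with x hx hmem hpos
    have h1 := hx a h hh hmem
    rw [← D.ofReal_wAvg_mul_volume a hh, ENNReal.mul_le_mul_iff_left (volume_cube_ne_zero a hh)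
      (volume_cube_ne_top a h), ← ENNReal.ofReal_mul D.A_pos.le] at h1
    exact (ENNReal.ofReal_le_ofReal_iff (mul_pos D.A_pos hpos).le).1 h1
  level_le_majorant := by
    intro x hx
    have h1 := D.wInt_le_majorant a h hh hS x hx
    rwa [← D.ofReal_wAvg_mul_volume a hh, ENNReal.mul_le_mul_iff_left (volume_cube_ne_zero a hh)
      (volume_cube_ne_top a h)] at h1
  osc_le := by
    refine (D.osc_le_wAvg hh hS).trans ?_
    gcongr
    · exact (D.wAvg_pos hh hS).le
    · linarith [D.N_pos]

/-- Induction along the dyadic tree: a superadditive functional `B` which dominates at the leaves,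
and which survives a change of reference whenever the oscillation of `b` exceeds the reference
level, dominates the integral of the dyadic approximations. -/
theorem dyadic_induction (D : BloomData b w N A S G)
    (g : ℝ → ℝ → ℝ → (Fin n → ℝ) → ℝ≥0∞) (B : (Fin n → ℝ) → ℝ → ℝ → ℝ → ℝ≥0∞)
    (hsplit : ∀ a h c μ, 0 < h → ∑ ε, B (childCorner a h ε) (h / 2) c μ ≤ B a h c μ)
    (hleaf : ∀ a h c μ, Admissible b w N A S G a h c μ → |cubeAvg a h b - c| ≤ 2 * N * μ →
      ∫⁻ x in Cube a h, g (cubeAvg a h b) c μ x ≤ B a h c μ)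
    (hswitch : ∀ m a h c μ, 0 < h → 0 < μ → Cube a h ⊆ S →
      (∀ᵐ x ∂volume.restrict (Cube a h), μ ≤ A * w x) →
      ENNReal.ofReal (2 * N * μ) * volume (Cube a h) ≤
        ∫⁻ x in Cube a h, ENNReal.ofReal |b x - c| →
      |cubeAvg a h b - c| ≤ 2 ^ n * (2 * N) * μ →
      ∫⁻ x in Cube a h, g (dyadicApprox b m a h x) (cubeAvg a h b) (wAvg w a h) x ≤
        B a h (cubeAvg a h b) (wAvg w a h) →
      ∫⁻ x in Cube a h, g (dyadicApprox b m a h x) c μ x ≤ B a h c μ) (m : ℕ) :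
    ∀ a h c μ, Admissible b w N A S G a h c μ →
      ∫⁻ x in Cube a h, g (dyadicApprox b m a h x) c μ x ≤ B a h c μ := by
  have hN := D.N_pos
  induction m with
  | zero =>
    intro a h c μ H
    have hμ := H.level_pos
    exact hleaf a h c μ H
      (abs_cubeAvg_sub_le D.locallyIntegrable a H.side_pos (by positivity) H.osc_le)
  | succ m ih =>
    intro a h c μ H
    have hμ := H.level_pos
    have hh := half_pos H.side_pos
    simp only [dyadicApprox]
    rw [lintegral_cube_eq_sum_children a H.side_pos
      fun ε x => g (dyadicApprox b m (childCorner a h ε) (h / 2) x) c μ x]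
    refine (Finset.sum_le_sum fun ε _ => ?_).trans (hsplit a h c μ H.side_pos)
    have hsub := child_subset a H.side_pos ε
    have hae := ae_restrict_of_ae_restrict_of_subset hsub H.level_le_weight
    rcases le_total (∫⁻ x in Cube (childCorner a h ε) (h / 2), ENNReal.ofReal |b x - c|)
      (ENNReal.ofReal (2 * N * μ) * volume (Cube (childCorner a h ε) (h / 2))) with hc | hc
    · exact ih _ _ _ _ ⟨hh, hμ, hsub.trans H.subset, hae,
        fun x hx => H.level_le_majorant x (hsub hx), hc⟩
    · refine hswitch m _ _ c μ hh hμ (hsub.trans H.subset) hae hc ?_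
        (ih _ _ _ _ (D.admissible_self hh (hsub.trans H.subset)))
      refine abs_cubeAvg_sub_le D.locallyIntegrable _ hh (by positivity) ?_
      refine (lintegral_mono_set hsub).trans (H.osc_le.trans_eq ?_)
      rw [volume_child a h ε, mul_assoc (2 ^ n : ℝ),
        ENNReal.ofReal_mul (by positivity : (0 : ℝ) ≤ 2 ^ n),
        ENNReal.ofReal_pow (by norm_num)]
      simp only [ENNReal.ofReal_ofNat]
      ring

theorem lintegral_exp_le (D : BloomData b w N A S G) (m : ℕ) (a : Fin n → ℝ) (h : ℝ)
    (hh : 0 < h) (hS : Cube a h ⊆ S) :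
    ∫⁻ x in Cube a h, ENNReal.ofReal
      (Real.exp (|dyadicApprox b m a h x - cubeAvg a h b| / (3 * (2 ^ n * (2 * N)) * A * w x))) ≤
      3 * volume (Cube a h) := by
  have hN := D.N_pos
  have hA := D.A_pos
  set B : (Fin n → ℝ) → ℝ → ℝ → ℝ → ℝ≥0∞ := fun a h c μ =>
    ENNReal.ofReal (3 / 2) * volume (Cube a h) +
      ENNReal.ofReal (3 / (2 * N * μ)) * ∫⁻ x in Cube a h, ENNReal.ofReal |b x - c| with hB
  have hself : ∀ a h, 0 < h → Cube a h ⊆ S →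
      B a h (cubeAvg a h b) (wAvg w a h) ≤ 3 * volume (Cube a h) := by
    intro a h hh hS
    have hμ := D.wAvg_pos hh hS
    simp only [hB]
    calc _ ≤ ENNReal.ofReal (3 / 2) * volume (Cube a h) +
          ENNReal.ofReal (3 / (2 * N * wAvg w a h)) *
            (ENNReal.ofReal (N * wAvg w a h) * volume (Cube a h)) := by
          gcongr; exact D.osc_le_wAvg hh hS
      _ = 3 * volume (Cube a h) := by
          rw [← mul_assoc, ← ENNReal.ofReal_mul (by positivity), ← add_mul,
            ← ENNReal.ofReal_add (by norm_num) (by positivity)]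
          congr 1
          rw [show 3 / 2 + 3 / (2 * N * wAvg w a h) * (N * wAvg w a h) = (3 : ℝ) by
            field_simp; norm_num]
          simp
  refine (D.dyadic_induction (fun y c _ x => ENNReal.ofReal
    (Real.exp (|y - c| / (3 * (2 ^ n * (2 * N)) * A * w x)))) B ?_ ?_ ?_ m a h _ _
    (D.admissible_self hh hS)).trans (hself a h hh hS)
  · intro a h c μ hh
    simp only [hB]
    rw [Finset.sum_add_distrib, ← Finset.mul_sum, ← Finset.mul_sum,
      ← volume_cube_eq_sum_children a hh,
      ← lintegral_cube_eq_sum_children a hh fun _ x => ENNReal.ofReal |b x - c|]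
  · intro a h c μ H hl
    have hμ := H.level_pos
    calc _ ≤ ∫⁻ x in Cube a h, ENNReal.ofReal (3 / 2) := by
          refine lintegral_mono_ae ?_
          filter_upwards [H.level_le_weight] with x hx
          have hw : 0 < w x := by
            by_contra! hc
            nlinarith
          refine ENNReal.ofReal_le_ofReal (le_trans ?_ exp_one_third_le)
          refine Real.exp_le_exp.2 ?_
          rw [div_le_iff₀ (by positivity)]
          have h2 : (1 : ℝ) ≤ 2 ^ n := one_le_pow₀ (by norm_num)
          calc _ ≤ 2 * N * μ := hl
            _ ≤ 1 * (2 * N * (A * w x)) := by rw [one_mul]; gcongr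
            _ ≤ 2 ^ n * (2 * N * (A * w x)) := by gcongr
            _ = _ := by ring
      _ ≤ _ := by
          rw [setLIntegral_const]
          exact le_self_add
  · intro m a h c μ hh hμ hS hae hI hl ih
    calc _ ≤ ∫⁻ x in Cube a h, ENNReal.ofReal (3 / 2) * ENNReal.ofReal
          (Real.exp (|dyadicApprox b m a h x - cubeAvg a h b| / (3 * (2 ^ n * (2 * N)) * A * w x))) := by
          refine lintegral_mono_ae ?_
          filter_upwards [hae] with x hx
          have hw : 0 < w x := by
            by_contra! hc
            nlinarith
          rw [← ENNReal.ofReal_mul (by norm_num)]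
          refine ENNReal.ofReal_le_ofReal ?_
          refine le_trans ?_ (mul_le_mul_of_nonneg_right exp_one_third_le (Real.exp_pos _).le)
          rw [← Real.exp_add]
          refine Real.exp_le_exp.2 ?_
          rw [div_le_iff₀ (by positivity), add_mul, div_mul_cancel₀ _ (by positivity)]
          calc _ ≤ |cubeAvg a h b - c| + |dyadicApprox b m a h x - cubeAvg a h b| := by
                rw [add_comm]; exact abs_sub_le _ _ _
            _ ≤ 2 ^ n * (2 * N) * (A * w x) + |dyadicApprox b m a h x - cubeAvg a h b| := by
                gcongr; exact hl.trans (by gcongr)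
            _ = _ := by ring
      _ = ENNReal.ofReal (3 / 2) * ∫⁻ x in Cube a h, ENNReal.ofReal
          (Real.exp (|dyadicApprox b m a h x - cubeAvg a h b| / (3 * (2 ^ n * (2 * N)) * A * w x))) :=
          lintegral_const_mul' _ _ ENNReal.ofReal_ne_top
      _ ≤ ENNReal.ofReal (3 / 2) * (3 * volume (Cube a h)) := by
          gcongr; exact ih.trans (hself a h hh hS)
      _ = ENNReal.ofReal (3 / 2) * volume (Cube a h) + ENNReal.ofReal (3 / (2 * N * μ)) *
            (ENNReal.ofReal (2 * N * μ) * volume (Cube a h)) := by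
          rw [← mul_assoc, ← mul_assoc, ← ENNReal.ofReal_mul (by positivity), ← add_mul,
            ← ENNReal.ofReal_add (by norm_num) (by positivity),
            div_mul_cancel₀ _ (by positivity),
            show (3 : ℝ≥0∞) = ENNReal.ofReal 3 by simp, ← ENNReal.ofReal_mul (by norm_num)]
          norm_num
      _ ≤ _ := by simp only [hB]; gcongr

theorem lintegral_dyadicApprox_le (D : BloomData b w N A S G) {q K : ℝ} (hq : 1 < q)
    (hK : 9 / 2 * (2 ^ n * (2 * N) * q ^ q * (3 * (2 ^ n * (2 * N)) * A) ^ (q - 1)) = K)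
    (m : ℕ) (a : Fin n → ℝ) (h : ℝ) (hh : 0 < h) (hS : Cube a h ⊆ S) :
    ∫⁻ x in Cube a h, ENNReal.ofReal
        (|(dyadicApprox b m a h x - cubeAvg a h b) / w x| ^ q * w x) ≤
      2 * ENNReal.ofReal K * ∫⁻ x in Cube a h, G x := by
  have hN := D.N_pos
  have hA := D.A_pos
  have hq0 : 0 < q := by linarith
  have hK0 : 0 < K := by rw [← hK]; positivity
  have h2n : (1 : ℝ) ≤ 2 ^ n := one_le_pow₀ (by norm_num)
  have hKle : 2 * N * (2 * N * A) ^ (q - 1) ≤ K := by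
    have hq1 : 0 ≤ q - 1 := by linarith
    have h1 : (1 : ℝ) ≤ q ^ q := Real.one_le_rpow hq.le hq0.le
    have h2 : 2 * N ≤ 2 ^ n * (2 * N) := le_mul_of_one_le_left (by positivity) h2n
    calc 2 * N * (2 * N * A) ^ (q - 1)
        ≤ 2 ^ n * (2 * N) * (3 * (2 ^ n * (2 * N)) * A) ^ (q - 1) := by
          gcongr <;> linarith
      _ ≤ 2 ^ n * (2 * N) * (3 * (2 ^ n * (2 * N)) * A) ^ (q - 1) * (9 / 2 * q ^ q) := by
          refine le_mul_of_one_le_right (by positivity) ?_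
          linarith
      _ = K := by rw [← hK]; ring
  set B : (Fin n → ℝ) → ℝ → ℝ → ℝ → ℝ≥0∞ := fun a h c μ =>
    ENNReal.ofReal K * (2 * ∫⁻ x in Cube a h, G x) +
      ENNReal.ofReal (K / N) * ∫⁻ x in Cube a h, ENNReal.ofReal |b x - c| with hB
  have hadd : ∀ m a h c μ, ∫⁻ x in Cube a h, (ENNReal.ofReal
      (|(dyadicApprox b m a h x - c) / w x| ^ q * w x) + ENNReal.ofReal (K * μ)) =
      (∫⁻ x in Cube a h, ENNReal.ofReal (|(dyadicApprox b m a h x - c) / w x| ^ q * w x)) +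
        ENNReal.ofReal (K * μ) * volume (Cube a h) := by
    intro m a h c μ
    rw [lintegral_add_right _ measurable_const, setLIntegral_const]
  have hself : ∀ m a h, 0 < h → Cube a h ⊆ S →
      ∫⁻ x in Cube a h, (ENNReal.ofReal
        (|(dyadicApprox b m a h x - cubeAvg a h b) / w x| ^ q * w x) +
          ENNReal.ofReal (K * wAvg w a h)) ≤ B a h (cubeAvg a h b) (wAvg w a h) →
      ∫⁻ x in Cube a h, ENNReal.ofReal
        (|(dyadicApprox b m a h x - cubeAvg a h b) / w x| ^ q * w x) ≤
      ENNReal.ofReal K * (2 * ∫⁻ x in Cube a h, G x) := by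
    intro m a h hh hS H
    have hμ := D.wAvg_pos hh hS
    rw [hadd] at H
    refine (ENNReal.add_le_add_iff_right (a := ENNReal.ofReal (K * wAvg w a h) *
      volume (Cube a h)) (ENNReal.mul_ne_top ENNReal.ofReal_ne_top
        (volume_cube_ne_top a h))).1 (H.trans ?_)
    refine add_le_add le_rfl ?_
    calc _ ≤ ENNReal.ofReal (K / N) * (ENNReal.ofReal (N * wAvg w a h) * volume (Cube a h)) := by
          gcongr; exact D.osc_le_wAvg hh hS
      _ = _ := by
          rw [← mul_assoc, ← ENNReal.ofReal_mul (by positivity)]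
          congr 2
          field_simp
  rw [mul_comm 2, mul_assoc]
  refine hself m a h hh hS (D.dyadic_induction (fun y c μ x => ENNReal.ofReal
    (|(y - c) / w x| ^ q * w x) + ENNReal.ofReal (K * μ)) B ?_ ?_ ?_ m a h _ _
    (D.admissible_self hh hS))
  · intro a h c μ hh
    simp only [hB]
    rw [Finset.sum_add_distrib, ← Finset.mul_sum, ← Finset.mul_sum, ← Finset.mul_sum,
      ← lintegral_cube_eq_sum_children a hh fun _ x => G x,
      ← lintegral_cube_eq_sum_children a hh fun _ x => ENNReal.ofReal |b x - c|]
  · intro a h c μ H hl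
    have hμ := H.level_pos
    calc _ ≤ ∫⁻ x in Cube a h, ENNReal.ofReal K * (2 * G x) := by
          refine lintegral_mono_ae ?_
          filter_upwards [H.level_le_weight, ae_restrict_mem (measurableSet_cube a h)] with x hx hm
          have hw : 0 < w x := by
            by_contra! hc
            nlinarith
          have h1 : ENNReal.ofReal (|(cubeAvg a h b - c) / w x| ^ q * w x) ≤
              ENNReal.ofReal (K * μ) := by
            refine ENNReal.ofReal_le_ofReal
              ((abs_div_rpow_mul_le hw (by positivity) hx hl hq).trans ?_)
            gcongr
          calc _ ≤ ENNReal.ofReal (K * μ) + ENNReal.ofReal (K * μ) := by gcongr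
            _ = ENNReal.ofReal K * (2 * ENNReal.ofReal μ) := by
                rw [ENNReal.ofReal_mul hK0.le]; ring
            _ ≤ _ := by gcongr; exact H.level_le_majorant x hm
      _ = ENNReal.ofReal K * (2 * ∫⁻ x in Cube a h, G x) := by
          rw [lintegral_const_mul' _ _ ENNReal.ofReal_ne_top,
            lintegral_const_mul' _ _ (by norm_num)]
      _ ≤ _ := le_self_add
  · intro m a h c μ hh hμ hS hae hI hl ih
    have hw : AEMeasurable w (volume.restrict (Cube a h)) :=
      D.weight_locallyIntegrable.aestronglyMeasurable.aemeasurable.restrict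
    have hd := measurable_dyadicApprox b m a h
    have hstep : ∫⁻ x in Cube a h, ENNReal.ofReal
        (|(dyadicApprox b m a h x - c) / w x| ^ q * w x) ≤
        ENNReal.ofReal K * (2 * ∫⁻ x in Cube a h, G x) +
          ENNReal.ofReal (K * μ) * volume (Cube a h) := by
      calc _ ≤ ∫⁻ x in Cube a h, (ENNReal.ofReal
            (|(dyadicApprox b m a h x - cubeAvg a h b) / w x| ^ q * w x) +
            ENNReal.ofReal (K / 3 * μ) * ENNReal.ofReal (Real.exp
            (|dyadicApprox b m a h x - cubeAvg a h b| / (3 * (2 ^ n * (2 * N)) * A * w x)))) := by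
            refine lintegral_mono_ae ?_
            filter_upwards [hae] with x hx
            have hw : 0 < w x := by
              by_contra! hc
              nlinarith
            rw [← ENNReal.ofReal_mul (by positivity),
              ← ENNReal.ofReal_add (by positivity) (by positivity)]
            refine ENNReal.ofReal_le_ofReal ((abs_sub_div_rpow_mul_le
              (y := dyadicApprox b m a h x) hw hμ (by positivity) hx hl hq).trans_eq ?_)
            rw [← hK]
            ring
        _ ≤ ENNReal.ofReal K * (2 * ∫⁻ x in Cube a h, G x) +
            ENNReal.ofReal (K / 3 * μ) * (3 * volume (Cube a h)) := by
            rw [lintegral_add_right' _ (by fun_prop),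
              lintegral_const_mul' _ _ ENNReal.ofReal_ne_top]
            gcongr
            · exact hself m a h hh hS ih
            · exact D.lintegral_exp_le m a h hh hS
        _ = _ := by
            rw [← mul_assoc (ENNReal.ofReal (K / 3 * μ)),
              show (3 : ℝ≥0∞) = ENNReal.ofReal 3 by simp, ← ENNReal.ofReal_mul (by positivity)]
            congr 3
            ring
    rw [hadd]
    calc _ ≤ ENNReal.ofReal K * (2 * ∫⁻ x in Cube a h, G x) +
          ENNReal.ofReal (K * μ) * volume (Cube a h) +
          ENNReal.ofReal (K * μ) * volume (Cube a h) := by gcongr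
      _ = ENNReal.ofReal K * (2 * ∫⁻ x in Cube a h, G x) +
          ENNReal.ofReal (K / N) * (ENNReal.ofReal (2 * N * μ) * volume (Cube a h)) := by
          rw [← mul_assoc (ENNReal.ofReal (K / N)), ← ENNReal.ofReal_mul (by positivity),
            show K / N * (2 * N * μ) = K * μ + K * μ by field_simp; ring,
            ENNReal.ofReal_add (by positivity) (by positivity)]
          ring
      _ ≤ _ := by simp only [hB]; gcongr

theorem lintegral_le (D : BloomData b w N A S G) {q K : ℝ} (hq : 1 < q)
    (hK : 9 / 2 * (2 ^ n * (2 * N) * q ^ q * (3 * (2 ^ n * (2 * N)) * A) ^ (q - 1)) = K)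
    (a : Fin n → ℝ) (h : ℝ) (hh : 0 < h) (hS : Cube a h ⊆ S) :
    ∫⁻ x in Cube a h, ENNReal.ofReal (|(b x - cubeAvg a h b) / w x| ^ q * w x) ≤
      2 * ENNReal.ofReal K * ∫⁻ x in Cube a h, G x := by
  have hw : AEMeasurable w (volume.restrict (Cube a h)) :=
    D.weight_locallyIntegrable.aestronglyMeasurable.aemeasurable.restrict
  have hmeas : ∀ m, AEMeasurable (fun x => ENNReal.ofReal
      (|(dyadicApprox b m a h x - cubeAvg a h b) / w x| ^ q * w x))
      (volume.restrict (Cube a h)) := by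
    intro m
    have hd := measurable_dyadicApprox b m a h
    fun_prop
  calc _ ≤ ∫⁻ x in Cube a h, Filter.liminf (fun m => ENNReal.ofReal
        (|(dyadicApprox b m a h x - cubeAvg a h b) / w x| ^ q * w x)) Filter.atTop := by
        refine lintegral_mono_ae ?_
        filter_upwards [ae_tendsto_dyadicApprox D.locallyIntegrable a hh] with x hx
        refine (Filter.Tendsto.liminf_eq (ENNReal.tendsto_ofReal ?_)).ge
        exact (((hx.sub_const _).div_const _).abs.rpow_const (.inr (by linarith))).mul_const _
    _ ≤ Filter.liminf (fun m => ∫⁻ x in Cube a h, ENNReal.ofReal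
        (|(dyadicApprox b m a h x - cubeAvg a h b) / w x| ^ q * w x)) Filter.atTop :=
        lintegral_liminf_le' hmeas
    _ ≤ Filter.liminf (fun _ : ℕ => 2 * ENNReal.ofReal K * ∫⁻ x in Cube a h, G x)
        Filter.atTop :=
        Filter.liminf_le_liminf (.of_forall fun m =>
          D.lintegral_dyadicApprox_le hq hK m a h hh hS)
    _ = _ := Filter.liminf_const _

end BloomData

theorem wInt_le_maxFn_mul_volume {n : ℕ} {w : (Fin n → ℝ) → ℝ} (hw : ∀ x, 0 ≤ w x)
    {a x : Fin n → ℝ} {h : ℝ} (hh : 0 < h) (hx : x ∈ Cube a h) :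
    wInt w a h ≤ maxFn w x * volume (Cube a h) := by
  rw [← ENNReal.div_le_iff (volume_cube_ne_zero a hh) (volume_cube_ne_top a h)]
  refine le_trans (le_of_eq ?_) (le_iSup_of_le a (le_iSup_of_le h (le_iSup_of_le hh
    (le_iSup_of_le hx le_rfl))))
  simp only [abs_of_nonneg (hw _), wInt]

theorem wInt_indicator_of_subset {n : ℕ} {w : (Fin n → ℝ) → ℝ} {S : Set (Fin n → ℝ)}
    {a : Fin n → ℝ} {h : ℝ} (hS : Cube a h ⊆ S) : wInt (S.indicator w) a h = wInt w a h :=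
  setLIntegral_congr_fun (measurableSet_cube a h) fun x hx => by
    simp only [indicator_of_mem (hS hx)]

theorem lintegral_div_rpow_mul_eq_zero {n : ℕ} {w f : (Fin n → ℝ) → ℝ} {a : Fin n → ℝ} {h q : ℝ}
    (hq : 0 < q) (hfw : ∀ᵐ x ∂volume.restrict (Cube a h), f x = 0 ∨ w x = 0) :
    ∫⁻ x in Cube a h, ENNReal.ofReal (|f x / w x| ^ q * w x) = 0 := by
  rw [← lintegral_zero (μ := volume.restrict (Cube a h))]
  refine lintegral_congr_ae ?_
  filter_upwards [hfw] with x hx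
  rcases hx with hx | hx <;> simp [hx, hq.ne']

theorem osc_le_bmoVY_mul {n : ℕ} {w b : (Fin n → ℝ) → ℝ} {a : Fin n → ℝ} {h : ℝ} (hh : 0 < h)
    (h0 : wInt w a h ≠ 0) (h1 : wInt w a h ≠ ⊤) :
    ∫⁻ x in Cube a h, ENNReal.ofReal |b x - cubeAvg a h b| ≤
      bmoVY (fun _ => (1 : ℝ)) (wInt w) b * wInt w a h := by
  rw [← ENNReal.div_le_iff h0 h1]
  refine le_trans (le_of_eq ?_) (le_iSup_of_le a (le_iSup_of_le h (le_iSup_of_le hh le_rfl)))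
  simp only [mul_one]

theorem two_mul_bloomConst_le {T N A q : ℝ} (hT : 0 ≤ T) (hN : 0 ≤ N) (hA : 0 ≤ A) (hq : 1 < q) :
    2 * (9 / 2 * (T * (2 * N) * q ^ q * (3 * (T * (2 * N)) * A) ^ (q - 1))) ≤
      (108 * T * q * N) ^ q * A ^ (q - 1) := by
  have hq0 : 0 < q := by linarith
  have hq1 : 0 ≤ q - 1 := by linarith
  have hTN : 0 ≤ T * N := by positivity
  have h1 : (108 * T * q * N) ^ q = 108 * (T * N) * (108 * (T * N)) ^ (q - 1) * q ^ q := by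
    rw [show 108 * T * q * N = 108 * (T * N) * q by ring, Real.mul_rpow (by positivity) hq0.le,
      mul_comm (108 * (T * N)) (_ ^ (q - 1)),
      ← Real.rpow_add_one' (by positivity) (by linarith), sub_add_cancel]
  rw [h1, show 3 * (T * (2 * N)) * A = 6 * (T * N) * A by ring,
    Real.mul_rpow (by positivity) hA]
  calc _ = 18 * (T * N) * (6 * (T * N)) ^ (q - 1) * q ^ q * A ^ (q - 1) := by ring
    _ ≤ _ := by gcongr <;> norm_num

/-- for `w ∈ A₁` and `b ∈ BMO_{1,w}`, for every `q > 1` and every cube `Q`,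
`((1/w(Q)) ∫_Q |(b - b_Q)/w|^q w)^{1/q} ≤ c_n ‖b‖_{BMO_{1,w}} q [w]_{A₁}^{1/q'} [w]_{A∞}^{1/q}`. -/
theorem stmt3 (n : ℕ) :
    ∃ c : ℝ, 0 < c ∧
      ∀ (w b : (Fin n → ℝ) → ℝ) (A1 : ℝ), IsWeight w →
        (∀ᵐ x ∂(volume : Measure (Fin n → ℝ)),
          maxFn w x ≤ ENNReal.ofReal A1 * ENNReal.ofReal (w x)) →
        LocallyIntegrable b volume → bmoVY (fun _ => (1 : ℝ)) (wInt w) b < ⊤ →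
        ∀ q : ℝ, 1 < q → ∀ (a : Fin n → ℝ) (h : ℝ), 0 < h →
          ((∫⁻ x in Cube a h,
              ENNReal.ofReal (|(b x - cubeAvg a h b) / w x| ^ q * w x)) / wInt w a h) ^ (1 / q)
            ≤ ENNReal.ofReal (c * q) * bmoVY (fun _ => (1 : ℝ)) (wInt w) b *
                ENNReal.ofReal A1 ^ ((q - 1) / q) * fwConst w ^ (1 / q) := by
  refine ⟨108 * 2 ^ n, by positivity, ?_⟩
  intro w b A1 hw hA1 hb hbmo q hq a h hh
  have hq0 : 0 < q := by linarith
  by_cases hw0 : wInt w a h = 0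
  · have hae := (lintegral_eq_zero_iff'
      hw.2.aestronglyMeasurable.aemeasurable.ennreal_ofReal.restrict).1 hw0
    rw [lintegral_div_rpow_mul_eq_zero (f := fun x => b x - cubeAvg a h b) hq0
      (hae.mono fun x hx => .inr (le_antisymm (ENNReal.ofReal_eq_zero.1 hx) (hw.1 x)))]
    simp [hq0]
  have hmax : ∀ᵐ x ∂volume.restrict (Cube a h), 0 < A1 ∧ 0 < w x := by
    filter_upwards [ae_restrict_of_ae hA1, ae_restrict_mem (measurableSet_cube a h)] with x hx hm
    have h1 : 0 < maxFn w x := by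
      refine pos_iff_ne_zero.2 fun h0 => hw0 ?_
      simpa [h0] using wInt_le_maxFn_mul_volume hw.1 hh hm
    have h2 := h1.trans_le hx
    rwa [ENNReal.mul_pos_iff, ENNReal.ofReal_pos, ENNReal.ofReal_pos] at h2
  have hA : 0 < A1 := by
    have : (ae (volume.restrict (Cube a h))).NeBot := by
      rw [ae_neBot, Ne, Measure.restrict_eq_zero]
      exact volume_cube_ne_zero a hh
    obtain ⟨x, hx⟩ := hmax.exists
    exact hx.1
  have hpos : ∀ᵐ x ∂volume.restrict (Cube a h), 0 < w x := hmax.mono fun x hx => hx.2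
  rcases eq_or_ne (bmoVY (fun _ => (1 : ℝ)) (wInt w) b) 0 with hβ | hβ
  · have hosc := osc_le_bmoVY_mul (b := b) hh hw0 (wInt_ne_top hw.2 a h)
    have hbm : AEMeasurable b (volume.restrict (Cube a h)) :=
      hb.aestronglyMeasurable.aemeasurable.restrict
    rw [hβ, zero_mul, nonpos_iff_eq_zero, lintegral_eq_zero_iff' (by fun_prop)] at hosc
    rw [lintegral_div_rpow_mul_eq_zero (f := fun x => b x - cubeAvg a h b) hq0
      (hosc.mono fun x hx => .inl (abs_nonpos_iff.1 (ENNReal.ofReal_eq_zero.1 hx)))]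
    simp [hq0]
  set β := bmoVY (fun _ => (1 : ℝ)) (wInt w) b with hβdef
  have hN : 0 < β.toReal := ENNReal.toReal_pos hβ hbmo.ne
  have hNβ : ENNReal.ofReal β.toReal = β := ENNReal.ofReal_toReal hbmo.ne
  have D : BloomData b w β.toReal A1 (Cube a h) (maxFn ((Cube a h).indicator w)) :=
    { locallyIntegrable := hb
      weight_locallyIntegrable := hw.2
      weight_pos := hpos
      N_pos := hN
      A_pos := hA
      osc_le := fun a' h' hh' hS => by
        rw [hNβ]
        exact osc_le_bmoVY_mul hh' (wInt_ne_zero hw.2 hh'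
          (ae_restrict_of_ae_restrict_of_subset hS hpos)) (wInt_ne_top hw.2 a' h')
      wInt_le := by
        filter_upwards [hA1] with x hx a' h' hh' hm
        exact (wInt_le_maxFn_mul_volume hw.1 hh' hm).trans (by gcongr)
      wInt_le_majorant := fun a' h' hh' hS x hx => by
        rw [← wInt_indicator_of_subset hS]
        exact wInt_le_maxFn_mul_volume (indicator_nonneg fun y _ => hw.1 y) hh' hx }
  have hmain := D.lintegral_le hq rfl a h hh subset_rfl
  have hfw : (∫⁻ x in Cube a h, maxFn ((Cube a h).indicator w) x) / wInt w a h ≤ fwConst w :=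
    le_iSup_of_le a (le_iSup_of_le h (le_iSup_of_le hh le_rfl))
  have hconst := two_mul_bloomConst_le (T := 2 ^ n) (by positivity) hN.le hA.le hq
  calc _ ≤ (ENNReal.ofReal ((108 * 2 ^ n * q * β.toReal) ^ q * A1 ^ (q - 1)) * fwConst w) ^
        (1 / q) := by
        refine ENNReal.rpow_le_rpow ?_ (by positivity)
        refine (ENNReal.div_le_div_right hmain _).trans ?_
        rw [mul_div_assoc]
        gcongr
        rw [show (2 : ℝ≥0∞) = ENNReal.ofReal 2 by simp, ← ENNReal.ofReal_mul (by norm_num)]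
        exact ENNReal.ofReal_le_ofReal hconst
    _ = _ := by
        rw [ENNReal.mul_rpow_of_nonneg _ _ (by positivity),
          ENNReal.ofReal_rpow_of_nonneg (by positivity) (by positivity),
          Real.mul_rpow (by positivity) (by positivity), ← Real.rpow_mul (by positivity),
          ← Real.rpow_mul hA.le, mul_one_div_cancel hq0.ne', Real.rpow_one, mul_one_div,
          ENNReal.ofReal_mul (by positivity), ENNReal.ofReal_mul (by positivity), hNβ,
          ENNReal.ofReal_rpow_of_pos hA]
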